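/- Assume T is strongly Lindelöf (every subspace is Lindelöf), X = ℝᵈ, and Γ: T ⇉ ℝᵈ is measurable, inner semicontinuous, solid and convex-valued. Then the μ-inner limit is idempotent on Γ: (μ-li (μ-li Γ))_t = (μ-li Γ)_t for every t ∈ T. -/

import Mathlib

open MeasureTheory Topology Filter Set

variable {T X : Type*}

/-- `Γ⁻¹(A) = {t : Γ t ∩ A ≠ ∅}`. -/
def svPreimage (Γ : T → Set X) (A : Set X) : Set T := {t | (Γ t ∩ A).Nonempty}

section Defs
variable [TopologicalSpace T] [MeasurableSpace T]

/-- The grill `𝓗_t^#` of the neighborhood system of `t`. -/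
def grill (t : T) : Set (Set T) := {B | ∀ O ∈ 𝓝 t, (B ∩ O).Nonempty}

/-- `𝓗_t^μ = {B Borel : ∃ O ∈ 𝓗_t, μ(B ∩ O) = μ(O)}`. -/
def Hmu (μ : Measure T) (t : T) : Set (Set T) :=
  {B | MeasurableSet B ∧ ∃ O ∈ 𝓝 t, μ (B ∩ O) = μ O}

/-- `𝓗_t^{μ#} = {B Borel : B ∩ O ≠ ∅ for all O ∈ 𝓗_t^μ}`. -/
def HmuSharp (μ : Measure T) (t : T) : Set (Set T) :=
  {B | MeasurableSet B ∧ ∀ O ∈ Hmu μ t, (B ∩ O).Nonempty}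

variable [TopologicalSpace X]

/-- The outer limit `(ls Γ)_t`. -/
def outerLimit (Γ : T → Set X) (t : T) : Set X :=
  ⋂ B ∈ 𝓝 t, closure (⋃ t' ∈ B, Γ t')

/-- The inner limit `(li Γ)_t`. -/
def innerLimit (Γ : T → Set X) (t : T) : Set X :=
  ⋂ B ∈ grill t, closure (⋃ t' ∈ B, Γ t')

/-- The μ-inner limit `(μ-li Γ)_t`. -/
def muInnerLimit (μ : Measure T) (Γ : T → Set X) (t : T) : Set X :=
  ⋂ B ∈ HmuSharp μ t, closure (⋃ t' ∈ B, Γ t')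

/-- `Γ` is outer regular in measure: `(μ-li Γ)_t ⊆ cl Γ_t` for all `t`. -/
def OuterMuRegular (μ : Measure T) (Γ : T → Set X) : Prop :=
  ∀ t, muInnerLimit μ Γ t ⊆ closure (Γ t)

end Defs

/-- A measure is strictly positive if every nonempty open set has positive measure. -/
def StrictlyPositive [TopologicalSpace T] [MeasurableSpace T] (μ : Measure T) : Prop :=
  ∀ O : Set T, IsOpen O → O.Nonempty → 0 < μ O

/-- `Γ` is inner semicontinuous if `Γ⁻¹(A)` is open for every open `A`. -/
def InnerSemicontinuous [TopologicalSpace T] [TopologicalSpace X] (Γ : T → Set X) : Prop :=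
  ∀ A : Set X, IsOpen A → IsOpen (svPreimage Γ A)

/-- `Γ` is measurable if `Γ⁻¹(A)` is Borel for every open `A`. -/
def MeasurableSV [MeasurableSpace T] [TopologicalSpace X] (Γ : T → Set X) : Prop :=
  ∀ A : Set X, IsOpen A → MeasurableSet (svPreimage Γ A)

/-- Strongly Lindelöf: every subspace is Lindelöf. -/
def StronglyLindelof (T : Type*) [TopologicalSpace T] : Prop :=
  ∀ s : Set T, IsLindelof s

section MuLimit
variable [TopologicalSpace T] [MeasurableSpace T] {μ : Measure T} {t : T}

lemma Hmu_mono {B C : Set T} (hB : B ∈ Hmu μ t) (hC : MeasurableSet C) (h : B ⊆ C) :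
    C ∈ Hmu μ t := by
  obtain ⟨-, O, hO, hBO⟩ := hB
  refine ⟨hC, O, hO, (measure_mono inter_subset_right).antisymm ?_⟩
  exact hBO.symm.le.trans (measure_mono (inter_subset_inter_left O h))

lemma mem_Hmu_of_mem_nhds {B : Set T} (hB : MeasurableSet B) (h : B ∈ 𝓝 t) : B ∈ Hmu μ t :=
  ⟨hB, B, h, by rw [inter_self]⟩

lemma mem_Hmu_of_measure_eq_top {B : Set T} (hB : MeasurableSet B) (h : μ B = ⊤) :
    B ∈ Hmu μ t :=
  ⟨hB, univ, univ_mem, by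
    rw [inter_univ, h]; exact (top_unique (h ▸ measure_mono (subset_univ B))).symm⟩

lemma compl_mem_HmuSharp {B : Set T} (hB : MeasurableSet B) (h : B ∉ Hmu μ t) :
    Bᶜ ∈ HmuSharp μ t := by
  refine ⟨hB.compl, fun O hO => ?_⟩
  by_contra hne
  refine h (Hmu_mono hO hB fun s hs => ?_)
  by_contra hsB
  exact hne ⟨s, hsB, hs⟩

variable [TopologicalSpace X] {Γ : T → Set X} {x : X}

lemma mem_Hmu_of_mem_muInnerLimit (hx : x ∈ muInnerLimit μ Γ t) {A : Set X} (hA : IsOpen A)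
    (hxA : x ∈ A) {W : Set T} (hW : MeasurableSet W) (hsub : svPreimage Γ A ⊆ W) :
    W ∈ Hmu μ t := by
  by_contra h
  obtain ⟨y, hyA, hy⟩ :=
    mem_closure_iff.1 (mem_iInter₂.1 hx _ (compl_mem_HmuSharp hW h)) A hA hxA
  obtain ⟨s, hs, hys⟩ := mem_iUnion₂.1 hy
  exact hs (hsub ⟨y, hys, hyA⟩)

lemma mem_muInnerLimit_of_forall_mem_Hmu
    (h : ∀ A, IsOpen A → x ∈ A → svPreimage Γ A ∈ Hmu μ t) : x ∈ muInnerLimit μ Γ t := by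
  refine mem_iInter₂.2 fun B hB => mem_closure_iff.2 fun A hA hxA => ?_
  obtain ⟨s, hsB, y, hy, hyA⟩ := hB.2 _ (h A hA hxA)
  exact ⟨y, hyA, mem_iUnion₂.2 ⟨s, hsB, hy⟩⟩

lemma muInnerLimit_mono {Δ : T → Set X} (h : ∀ s, Γ s ⊆ Δ s) (t : T) :
    muInnerLimit μ Γ t ⊆ muInnerLimit μ Δ t :=
  iInter₂_mono fun _ _ => closure_mono (iUnion₂_mono fun s _ => h s)

lemma subset_muInnerLimit (hmeas : MeasurableSV Γ) (hisc : InnerSemicontinuous Γ) (t : T) :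
    Γ t ⊆ muInnerLimit μ Γ t := fun x hx =>
  mem_muInnerLimit_of_forall_mem_Hmu fun A hA hxA =>
    mem_Hmu_of_mem_nhds (hmeas A hA) ((hisc A hA).mem_nhds ⟨x, hx, hxA⟩)

/-- A Borel set of finite measure that belongs to `𝓗_t^μ` is of full measure in an open
neighborhood of `t`. -/
lemma exists_isOpen_measure_diff_eq_zero {V : Set T} (hfin : μ V ≠ ⊤) (hV : V ∈ Hmu μ t) :
    ∃ O, IsOpen O ∧ t ∈ O ∧ μ (O \ V) = 0 := by
  obtain ⟨hVm, O, hO, hVO⟩ := hV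
  refine ⟨interior O, isOpen_interior, mem_interior_iff_mem_nhds.2 hO,
    measure_mono_null (sdiff_subset_sdiff_left interior_subset) ?_⟩
  have hsplit := measure_inter_add_sdiff O hVm (μ := μ)
  rw [inter_comm, hVO] at hsplit
  have hOfin : μ O ≠ ⊤ := hVO ▸ measure_ne_top_of_subset inter_subset_left hfin
  exact (ENNReal.add_right_inj hOfin).1 (hsplit.trans (add_zero _).symm)

/-- In a strongly Lindelöf space, the union of the open sets in which `V` has full measure
exceeds `V` by a null set. -/
lemma measure_sUnion_diff_eq_zero (hT : StronglyLindelof T) (V : Set T) :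
    μ (⋃₀ {O | IsOpen O ∧ μ (O \ V) = 0} \ V) = 0 := by
  obtain ⟨S, hS, hSc, hcover⟩ :=
    (hT (⋃₀ {O | IsOpen O ∧ μ (O \ V) = 0})).elim_countable_subcover_image
      (b := {O | IsOpen O ∧ μ (O \ V) = 0}) (c := id) (fun O hO => hO.1)
      (by rw [sUnion_eq_biUnion]; rfl)
  refine measure_mono_null (sdiff_subset_sdiff_left hcover) ?_
  simp only [iUnion_sdiff]
  exact (measure_biUnion_null_iff hSc).2 fun O hO => (hS hO).2

lemma muInnerLimit_muInnerLimit_subset [BorelSpace T] (hT : StronglyLindelof T)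
    (hmeas : MeasurableSV Γ) (t : T) :
    muInnerLimit μ (muInnerLimit μ Γ) t ⊆ muInnerLimit μ Γ t := by
  refine fun x hx => mem_muInnerLimit_of_forall_mem_Hmu fun A hA hxA => ?_
  set V := svPreimage Γ A
  have hV : MeasurableSet V := hmeas A hA
  by_cases hfin : μ V = ⊤
  · exact mem_Hmu_of_measure_eq_top hV hfin
  set W := ⋃₀ {O | IsOpen O ∧ μ (O \ V) = 0}
  have hW : MeasurableSet W := (isOpen_sUnion fun O hO => hO.1).measurableSet
  have hsub : svPreimage (muInnerLimit μ Γ) A ⊆ W := by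
    rintro s ⟨y, hy, hyA⟩
    obtain ⟨O, hO, hsO, hOV⟩ := exists_isOpen_measure_diff_eq_zero hfin
      (mem_Hmu_of_mem_muInnerLimit hy hA hyA hV subset_rfl)
    exact ⟨O, ⟨hO, hOV⟩, hsO⟩
  obtain ⟨-, O, hO, hWO⟩ := mem_Hmu_of_mem_muInnerLimit hx hA hxA hW hsub
  refine ⟨hV, O, hO, (measure_mono inter_subset_right).antisymm ?_⟩
  calc μ O = μ (W ∩ O) := hWO.symm
    _ ≤ μ (V ∩ O ∪ W \ V) := measure_mono fun s hs => by
        by_cases hsV : s ∈ V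
        · exact Or.inl ⟨hsV, hs.2⟩
        · exact Or.inr ⟨hs.1, hsV⟩
    _ ≤ μ (V ∩ O) + μ (W \ V) := measure_union_le _ _
    _ = μ (V ∩ O) := by rw [measure_sUnion_diff_eq_zero hT V, add_zero]

end MuLimit

/-- on a strongly Lindelöf space, the μ-inner limit is idempotent on a
measurable inner semicontinuous solid convex-valued mapping into `ℝᵈ`. -/
theorem muInnerLimit_idem
    [TopologicalSpace T] [MeasurableSpace T] [BorelSpace T]
    (hT : StronglyLindelof T) {d : ℕ}
    (μ : Measure T) (hμ : StrictlyPositive μ)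
    (Γ : T → Set (EuclideanSpace ℝ (Fin d)))
    (hmeas : MeasurableSV Γ) (hisc : InnerSemicontinuous Γ)
    (hcl : ∀ t, IsClosed (Γ t)) (hsolid : ∀ t, (interior (Γ t)).Nonempty)
    (hconv : ∀ t, Convex ℝ (Γ t)) (t : T) :
    muInnerLimit μ (muInnerLimit μ Γ) t = muInnerLimit μ Γ t := by
  exact (muInnerLimit_muInnerLimit_subset hT hmeas t).antisymm
    (muInnerLimit_mono (subset_muInnerLimit hmeas hisc) t)
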